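/- arXiv:2408.10832 — 5 statements merged into one kernel-verified Lean document; each statement's English description precedes it below -/
import Mathlib

section
/- Let C be a monoidal category, e : C ≌ C a monoidal equivalence with functor α, tensorator η and inverse-counit isomorphism ξ, and let (X, ψ) be an object of the Drinfeld center Z(C). Then the family ψ^α satisfies the half-braiding multiplicativity (hexagon) condition: for all objects Y, Z of C, ψ^α_{Y ⊗ Z} = (id_Y ⊗ ψ^α_Z) ∘ (ψ^α_Y ⊗ id_Z). Consequently (α(X), ψ^α) is an object of Z(C). -/
open CategoryTheory MonoidalCategory

universe v u

namespace DrinfeldConj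

variable {C : Type u} [Category.{v} C] [MonoidalCategory C]

/-- The conjugated half-braiding `ψ^α_Y := (ξ_Y⁻¹ ⊗ id_{αX}) ∘ η_{α⁻¹Y,X}⁻¹ ∘ α(ψ_{α⁻¹Y})
∘ η_{X,α⁻¹Y} ∘ (id_{αX} ⊗ ξ_Y)`, where `ξ_Y : Y ≅ α(α⁻¹Y)` is the inverse of the counit
isomorphism of the equivalence and `η` is the tensorator of `α`. -/
noncomputable def conj (α : C ⥤ C) [α.Monoidal] [α.IsEquivalence]
    {X : C} (ψ : ∀ Y : C, X ⊗ Y ≅ Y ⊗ X) (Y : C) :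
    α.obj X ⊗ Y ≅ Y ⊗ α.obj X :=
  whiskerLeftIso (α.obj X) (α.asEquivalence.counitIso.app Y).symm ≪≫
    Functor.Monoidal.μIso α X (α.asEquivalence.inverse.obj Y) ≪≫
    α.mapIso (ψ (α.asEquivalence.inverse.obj Y)) ≪≫
    (Functor.Monoidal.μIso α (α.asEquivalence.inverse.obj Y) X).symm ≪≫
    whiskerRightIso (α.asEquivalence.counitIso.app Y) (α.obj X)

open Functor.LaxMonoidal Functor.OplaxMonoidal

/-- The conjugated family intertwines any `f : Y ⟶ α.obj A` with the image of `ψ A` under `α`. -/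
theorem whiskerLeft_comp_map_eq_conj_comp (α : C ⥤ C) [α.Monoidal] [α.IsEquivalence]
    {X : C} (ψ : ∀ Y : C, X ⊗ Y ≅ Y ⊗ X)
    (hnat : ∀ {Y Z : C} (f : Y ⟶ Z), (X ◁ f) ≫ (ψ Z).hom = (ψ Y).hom ≫ (f ▷ X))
    {Y A : C} (f : Y ⟶ α.obj A) :
    α.obj X ◁ f ≫ μ α X A ≫ α.map (ψ A).hom ≫ δ α A X =
      (conj α ψ Y).hom ≫ f ▷ α.obj X := by
  obtain ⟨i, hi⟩ : ∃ i : α.obj (α.asEquivalence.inverse.obj Y) ≅ Y,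
      (conj α ψ Y).hom = α.obj X ◁ i.inv ≫ μ α X _ ≫ α.map (ψ _).hom ≫ δ α _ X ≫
        i.hom ▷ α.obj X := ⟨α.asEquivalence.counitIso.app Y, rfl⟩
  obtain ⟨g, hg⟩ := α.map_surjective (i.hom ≫ f)
  obtain rfl : f = i.inv ≫ α.map g := by simp [hg]
  rw [hi, MonoidalCategory.whiskerLeft_comp_assoc, μ_natural_right_assoc, ← α.map_comp_assoc,
    hnat, α.map_comp_assoc, ← δ_natural_left]
  simp

/-- Conjugating a natural family of isomorphisms gives a natural family. -/
theorem conj_naturality (α : C ⥤ C) [α.Monoidal] [α.IsEquivalence]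
    {X : C} (ψ : ∀ Y : C, X ⊗ Y ≅ Y ⊗ X)
    (hnat : ∀ {Y Z : C} (f : Y ⟶ Z), (X ◁ f) ≫ (ψ Z).hom = (ψ Y).hom ≫ (f ▷ X))
    {Y Z : C} (f : Y ⟶ Z) :
    (α.obj X ◁ f) ≫ (conj α ψ Z).hom = (conj α ψ Y).hom ≫ (f ▷ α.obj X) := by
  rw [← cancel_mono ((α.objObjPreimageIso Z).inv ▷ α.obj X), Category.assoc, Category.assoc,
    ← whiskerLeft_comp_map_eq_conj_comp α ψ hnat, ← comp_whiskerRight,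
    ← whiskerLeft_comp_map_eq_conj_comp α ψ hnat, MonoidalCategory.whiskerLeft_comp_assoc]

/-- On objects in the image of `α`, the conjugated family is the image of the original one. -/
theorem conj_obj_hom (α : C ⥤ C) [α.Monoidal] [α.IsEquivalence]
    {X : C} (ψ : ∀ Y : C, X ⊗ Y ≅ Y ⊗ X)
    (hnat : ∀ {Y Z : C} (f : Y ⟶ Z), (X ◁ f) ≫ (ψ Z).hom = (ψ Y).hom ≫ (f ▷ X)) (A : C) :
    (conj α ψ (α.obj A)).hom = μ α X A ≫ α.map (ψ A).hom ≫ δ α A X := by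
  simpa using (whiskerLeft_comp_map_eq_conj_comp α ψ hnat (𝟙 (α.obj A))).symm

/-- The hexagon condition for the conjugated family on objects in the image of `α`. -/
theorem conj_obj_tensor_obj_hom (α : C ⥤ C) [α.Monoidal] [α.IsEquivalence]
    {X : C} (ψ : ∀ Y : C, X ⊗ Y ≅ Y ⊗ X)
    (hnat : ∀ {Y Z : C} (f : Y ⟶ Z), (X ◁ f) ≫ (ψ Z).hom = (ψ Y).hom ≫ (f ▷ X))
    (hmon : ∀ Y Z : C, (ψ (Y ⊗ Z)).hom =
      (α_ X Y Z).inv ≫ ((ψ Y).hom ▷ Z) ≫ (α_ Y X Z).hom ≫ (Y ◁ (ψ Z).hom) ≫ (α_ Y Z X).inv)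
    (A B : C) :
    (conj α ψ (α.obj A ⊗ α.obj B)).hom =
      (α_ (α.obj X) (α.obj A) (α.obj B)).inv ≫ ((conj α ψ (α.obj A)).hom ▷ α.obj B) ≫
        (α_ (α.obj A) (α.obj X) (α.obj B)).hom ≫ (α.obj A ◁ (conj α ψ (α.obj B)).hom) ≫
          (α_ (α.obj A) (α.obj B) (α.obj X)).inv := by
  rw [← cancel_mono (μ α A B ▷ α.obj X), ← conj_naturality α ψ hnat, conj_obj_hom α ψ hnat,
    conj_obj_hom α ψ hnat, conj_obj_hom α ψ hnat, hmon]
  simp only [Functor.map_comp, Functor.Monoidal.map_associator,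
    Functor.Monoidal.map_associator_inv, Functor.Monoidal.map_whiskerLeft,
    Functor.Monoidal.map_whiskerRight, MonoidalCategory.whiskerLeft_comp, comp_whiskerRight,
    Category.assoc, Functor.Monoidal.μ_δ_assoc, Functor.Monoidal.μ_δ, Category.comp_id,
    Functor.Monoidal.whiskerLeft_μ_δ_assoc]

/-- A natural family satisfying the hexagon condition at `A, B` satisfies it at any objects
`Y, Z` isomorphic to these. -/
theorem hexagon_of_iso {X : C} (ψ : ∀ Y : C, X ⊗ Y ≅ Y ⊗ X)
    (hnat : ∀ {Y Z : C} (f : Y ⟶ Z), (X ◁ f) ≫ (ψ Z).hom = (ψ Y).hom ≫ (f ▷ X))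
    {Y Z A B : C} (f : Y ≅ A) (g : Z ≅ B)
    (h : (ψ (A ⊗ B)).hom = (α_ X A B).inv ≫ ((ψ A).hom ▷ B) ≫ (α_ A X B).hom ≫
      (A ◁ (ψ B).hom) ≫ (α_ A B X).inv) :
    (ψ (Y ⊗ Z)).hom =
      (α_ X Y Z).inv ≫ ((ψ Y).hom ▷ Z) ≫ (α_ Y X Z).hom ≫ (Y ◁ (ψ Z).hom) ≫ (α_ Y Z X).inv := by
  rw [← cancel_mono ((f.hom ⊗ₘ g.hom) ▷ X), ← hnat, h, MonoidalCategory.tensorHom_def]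
  simp only [MonoidalCategory.whiskerLeft_comp, comp_whiskerRight, Category.assoc]
  rw [associator_inv_naturality_right_assoc, associator_inv_naturality_middle_assoc,
    whisker_exchange_assoc, ← comp_whiskerRight_assoc, hnat]
  simp only [comp_whiskerRight, Category.assoc]
  rw [associator_naturality_right_assoc, associator_naturality_left_assoc,
    ← MonoidalCategory.whiskerLeft_comp_assoc, hnat]
  simp only [MonoidalCategory.whiskerLeft_comp, Category.assoc]
  rw [← whisker_exchange_assoc, associator_inv_naturality_middle,
    associator_inv_naturality_left_assoc]

/-- `ψ^α` satisfies the half-braiding multiplicativity (hexagon) condition,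
and consequently `(α(X), ψ^α)` is an object of the Drinfeld center `Z(C)`. -/
theorem conj_monoidal (α : C ⥤ C) [α.Monoidal] [α.IsEquivalence]
    {X : C} (ψ : ∀ Y : C, X ⊗ Y ≅ Y ⊗ X)
    (hnat : ∀ {Y Z : C} (f : Y ⟶ Z), (X ◁ f) ≫ (ψ Z).hom = (ψ Y).hom ≫ (f ▷ X))
    (hmon : ∀ Y Z : C, (ψ (Y ⊗ Z)).hom =
      (α_ X Y Z).inv ≫ ((ψ Y).hom ▷ Z) ≫ (α_ Y X Z).hom ≫ (Y ◁ (ψ Z).hom) ≫ (α_ Y Z X).inv) :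
    (∀ Y Z : C, (conj α ψ (Y ⊗ Z)).hom =
      (α_ (α.obj X) Y Z).inv ≫ ((conj α ψ Y).hom ▷ Z) ≫ (α_ Y (α.obj X) Z).hom ≫
        (Y ◁ (conj α ψ Z).hom) ≫ (α_ Y Z (α.obj X)).inv) ∧
    ∃ b : HalfBraiding (α.obj X), ∀ Y : C, b.β Y = conj α ψ Y := by
  have hex : ∀ Y Z : C, (conj α ψ (Y ⊗ Z)).hom =
      (α_ (α.obj X) Y Z).inv ≫ ((conj α ψ Y).hom ▷ Z) ≫ (α_ Y (α.obj X) Z).hom ≫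
        (Y ◁ (conj α ψ Z).hom) ≫ (α_ Y Z (α.obj X)).inv := fun Y Z =>
    hexagon_of_iso (conj α ψ) (conj_naturality α ψ hnat) (α.objObjPreimageIso Y).symm
      (α.objObjPreimageIso Z).symm (conj_obj_tensor_obj_hom α ψ hnat hmon _ _)
  exact ⟨hex, ⟨conj α ψ, hex, conj_naturality α ψ hnat⟩, fun _ => rfl⟩

end DrinfeldConj
end

section
/- Let C be a monoidal category, e : C ≌ C a monoidal equivalence with functor α, tensorator η and inverse-counit isomorphism ξ. If f : X ⟶ X' is a morphism of the Drinfeld center from (X, ψ) to (X', φ), i.e. (id_Y ⊗ f) ∘ ψ_Y = φ_Y ∘ (f ⊗ id_Y) for all Y, then α(f) is a morphism of the center from (α(X), ψ^α) to (α(X'), φ^α), i.e. (id_Y ⊗ α(f)) ∘ ψ^α_Y = φ^α_Y ∘ (α(f) ⊗ id_Y) for all objects Y of C. -/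
open CategoryTheory MonoidalCategory

universe v u

namespace DrinfeldConj

variable {C : Type u} [Category.{v} C] [MonoidalCategory C]

/-- A morphism `f` intertwining `b : X ⊗ Z ⟶ Z ⊗ X` and `b' : X' ⊗ Z ⟶ Z ⊗ X'` is sent by a
monoidal functor `α` to a morphism intertwining their images, transported along any isomorphism
`α.obj Z ≅ Y`. -/
lemma map_whiskerRight_comp_transport (α : C ⥤ C) [α.Monoidal] {X X' Y Z : C}
    (b : X ⊗ Z ⟶ Z ⊗ X) (b' : X' ⊗ Z ⟶ Z ⊗ X') (f : X ⟶ X')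
    (hf : f ▷ Z ≫ b' = b ≫ Z ◁ f) (i : α.obj Z ≅ Y) :
    α.map f ▷ Y ≫ α.obj X' ◁ i.inv ≫ Functor.LaxMonoidal.μ α X' Z ≫ α.map b' ≫
        Functor.OplaxMonoidal.δ α Z X' ≫ i.hom ▷ α.obj X' =
      (α.obj X ◁ i.inv ≫ Functor.LaxMonoidal.μ α X Z ≫ α.map b ≫
        Functor.OplaxMonoidal.δ α Z X ≫ i.hom ▷ α.obj X) ≫ Y ◁ α.map f := by
  have hαf : α.map (f ▷ Z) ≫ α.map b' = α.map b ≫ α.map (Z ◁ f) := by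
    rw [← α.map_comp, hf, α.map_comp]
  simp only [Category.assoc]
  rw [← whisker_exchange_assoc, Functor.LaxMonoidal.μ_natural_left_assoc, reassoc_of% hαf,
    ← Functor.OplaxMonoidal.δ_natural_right_assoc, whisker_exchange]

/-- if `f : X ⟶ X'` is a morphism of the Drinfeld center from `(X, ψ)` to
`(X', φ)`, then `α(f)` is a morphism of the center from `(α(X), ψ^α)` to `(α(X'), φ^α)`. -/
theorem map_conj_central (α : C ⥤ C) [α.Monoidal] [α.IsEquivalence]
    {X X' : C} (ψ : ∀ Y : C, X ⊗ Y ≅ Y ⊗ X) (φ : ∀ Y : C, X' ⊗ Y ≅ Y ⊗ X')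
    (hψnat : ∀ {Y Z : C} (f : Y ⟶ Z), (X ◁ f) ≫ (ψ Z).hom = (ψ Y).hom ≫ (f ▷ X))
    (hψmon : ∀ Y Z : C, (ψ (Y ⊗ Z)).hom =
      (α_ X Y Z).inv ≫ ((ψ Y).hom ▷ Z) ≫ (α_ Y X Z).hom ≫ (Y ◁ (ψ Z).hom) ≫ (α_ Y Z X).inv)
    (hφnat : ∀ {Y Z : C} (f : Y ⟶ Z), (X' ◁ f) ≫ (φ Z).hom = (φ Y).hom ≫ (f ▷ X'))
    (hφmon : ∀ Y Z : C, (φ (Y ⊗ Z)).hom =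
      (α_ X' Y Z).inv ≫ ((φ Y).hom ▷ Z) ≫ (α_ Y X' Z).hom ≫ (Y ◁ (φ Z).hom) ≫ (α_ Y Z X').inv)
    (f : X ⟶ X')
    (hf : ∀ Y : C, (f ▷ Y) ≫ (φ Y).hom = (ψ Y).hom ≫ (Y ◁ f)) (Y : C) :
    (α.map f ▷ Y) ≫ (conj α φ Y).hom = (conj α ψ Y).hom ≫ (Y ◁ α.map f) := by
  exact map_whiskerRight_comp_transport α (ψ _).hom (φ _).hom f (hf _)
    (α.asEquivalence.counitIso.app Y)

end DrinfeldConj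
end

section
/- Let C be a monoidal category, e : C ≌ C a monoidal equivalence with functor α, tensorator η and inverse-counit isomorphism ξ. The induced endofunctor of the Drinfeld center Z(C) is braided: for all objects (X, ψ) and (Y, φ) of Z(C), ψ^α_{α(Y)} = η_{Y,X}^{-1} ∘ α(ψ_Y) ∘ η_{X,Y}, where ψ_Y is the braiding of Z(C) evaluated at the pair ((X, ψ), (Y, φ)) and ψ^α_{α(Y)} is the braiding evaluated at ((α(X), ψ^α), (α(Y), φ^α)). -/
open CategoryTheory MonoidalCategory

universe v u

namespace DrinfeldConj

variable {C : Type u} [Category.{v} C] [MonoidalCategory C]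

/-- Conjugating `α(ψ_Z)` by `α(u)` and a retraction `c` of it, for `u : Y ⟶ Z`, gives `α(ψ_Y)`,
up to the tensorator of `α`. -/
theorem conj_retract (α : C ⥤ C) [α.Monoidal] {X Y Z : C} (ψ : ∀ U : C, X ⊗ U ⟶ U ⊗ X)
    (hψnat : ∀ {U V : C} (f : U ⟶ V), (X ◁ f) ≫ ψ V = ψ U ≫ (f ▷ X))
    (u : Y ⟶ Z) (c : α.obj Z ⟶ α.obj Y) (huc : α.map u ≫ c = 𝟙 (α.obj Y)) :
    α.obj X ◁ α.map u ≫ Functor.LaxMonoidal.μ α X Z ≫ α.map (ψ Z) ≫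
        Functor.OplaxMonoidal.δ α Z X ≫ c ▷ α.obj X =
      Functor.LaxMonoidal.μ α X Y ≫ α.map (ψ Y) ≫ Functor.OplaxMonoidal.δ α Y X := by
  rw [Functor.LaxMonoidal.μ_natural_right_assoc, ← Functor.map_comp_assoc, hψnat,
    Functor.map_comp_assoc, ← Functor.OplaxMonoidal.δ_natural_left_assoc,
    ← comp_whiskerRight, huc, id_whiskerRight, Category.comp_id]

/-- the induced endofunctor of the Drinfeld center is braided: for center
objects `(X, ψ)` and `(Y, φ)`, `ψ^α_{α(Y)} = η_{Y,X}⁻¹ ∘ α(ψ_Y) ∘ η_{X,Y}` (the braiding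
of `Z(C)` on a pair `((X, ψ), (Y, φ))` being `ψ_Y`). -/
theorem conj_braided (α : C ⥤ C) [α.Monoidal] [α.IsEquivalence]
    {X Y : C} (ψ : ∀ U : C, X ⊗ U ≅ U ⊗ X) (φ : ∀ U : C, Y ⊗ U ≅ U ⊗ Y)
    (hψnat : ∀ {U V : C} (f : U ⟶ V), (X ◁ f) ≫ (ψ V).hom = (ψ U).hom ≫ (f ▷ X))
    (hψmon : ∀ U V : C, (ψ (U ⊗ V)).hom =
      (α_ X U V).inv ≫ ((ψ U).hom ▷ V) ≫ (α_ U X V).hom ≫ (U ◁ (ψ V).hom) ≫ (α_ U V X).inv)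
    (hφnat : ∀ {U V : C} (f : U ⟶ V), (Y ◁ f) ≫ (φ V).hom = (φ U).hom ≫ (f ▷ Y))
    (hφmon : ∀ U V : C, (φ (U ⊗ V)).hom =
      (α_ Y U V).inv ≫ ((φ U).hom ▷ V) ≫ (α_ U Y V).hom ≫ (U ◁ (φ V).hom) ≫ (α_ U V Y).inv) :
    (conj α ψ (α.obj Y)).hom =
      Functor.LaxMonoidal.μ α X Y ≫ α.map (ψ Y).hom ≫ (Functor.Monoidal.μIso α Y X).inv := by
  have hunit : α.asEquivalence.counitIso.inv.app (α.obj Y) =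
      α.map (α.asEquivalence.unitIso.hom.app Y) :=
    α.asEquivalence.counitInv_app_functor Y
  have hretract : α.map (α.asEquivalence.unitIso.hom.app Y) ≫
      α.asEquivalence.counitIso.hom.app (α.obj Y) = 𝟙 (α.obj Y) :=
    α.asEquivalence.functor_unit_comp Y
  refine Eq.trans ?_ (conj_retract α (fun U => (ψ U).hom) hψnat _ _ hretract)
  rw [← hunit]
  rfl

end DrinfeldConj
end

section
/- Let C be a monoidal category and let e, e' : C ≌ C be two monoidal equivalences with functors α, β, tensorators η^α, η^β and inverse-counit isomorphisms ξ^α, ξ^β. If π : α ⟹ β is a monoidal natural isomorphism, then for every object (X, ψ) of the Drinfeld center Z(C), the component π_X is a morphism of the center from (α(X), ψ^α) to (β(X), ψ^β); that is, for all objects Y of C, ψ^β_Y ∘ (π_X ⊗ id_Y) = (id_Y ⊗ π_X) ∘ ψ^α_Y. -/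
open CategoryTheory MonoidalCategory

universe v u

namespace DrinfeldConj

variable {C : Type u} [Category.{v} C] [MonoidalCategory C]

/-- The conjugated half-braiding can be computed along any morphism `f : α W ⟶ Y`, not only
along the counit. -/
lemma whiskerLeft_comp_conj_hom (α : C ⥤ C) [α.Monoidal] [α.IsEquivalence]
    {X : C} (ψ : ∀ Y : C, X ⊗ Y ≅ Y ⊗ X)
    (hnat : ∀ {Y Z : C} (f : Y ⟶ Z), (X ◁ f) ≫ (ψ Z).hom = (ψ Y).hom ≫ (f ▷ X))
    {W Y : C} (f : α.obj W ⟶ Y) :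
    (α.obj X ◁ f) ≫ (conj α ψ Y).hom =
      Functor.LaxMonoidal.μ α X W ≫ α.map (ψ W).hom ≫ Functor.OplaxMonoidal.δ α W X ≫
        (f ▷ α.obj X) := by
  obtain ⟨V, c, hconj⟩ : ∃ (V : C) (c : α.obj V ≅ Y), (conj α ψ Y).hom =
      α.obj X ◁ c.inv ≫ Functor.LaxMonoidal.μ α X V ≫ α.map (ψ V).hom ≫
        Functor.OplaxMonoidal.δ α V X ≫ c.hom ▷ α.obj X :=
    ⟨α.asEquivalence.inverse.obj Y, α.asEquivalence.counitIso.app Y, rfl⟩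
  obtain ⟨g, hg⟩ := α.map_surjective (f ≫ c.inv)
  obtain rfl : f = α.map g ≫ c.hom := by simp [hg]
  rw [hconj, ← whiskerLeft_comp_assoc, Category.assoc, Iso.hom_inv_id, Category.comp_id,
    Functor.LaxMonoidal.μ_natural_right_assoc, ← α.map_comp_assoc, hnat, α.map_comp_assoc,
    comp_whiskerRight, ← Functor.OplaxMonoidal.δ_natural_left_assoc]

/-- The oplax structure maps are natural along a monoidal transformation. -/
lemma app_tensor_comp_δ {α β : C ⥤ C} [α.Monoidal] [β.Monoidal] (τ : α ⟶ β)
    [NatTrans.IsMonoidal τ] (X Y : C) :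
    τ.app (X ⊗ Y) ≫ Functor.OplaxMonoidal.δ β X Y =
      Functor.OplaxMonoidal.δ α X Y ≫ (τ.app X ⊗ₘ τ.app Y) := by
  rw [← cancel_epi (Functor.LaxMonoidal.μ α X Y), NatTrans.IsMonoidal.tensor_assoc]
  simp

/-- if `π : α ⟹ β` is a monoidal natural isomorphism between monoidal
equivalences, then for every center object `(X, ψ)` the component `π_X` is a morphism of the
center from `(α(X), ψ^α)` to `(β(X), ψ^β)`: `ψ^β_Y ∘ (π_X ⊗ id_Y) = (id_Y ⊗ π_X) ∘ ψ^α_Y`. -/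
theorem conj_nat_iso_central (α β : C ⥤ C) [α.Monoidal] [α.IsEquivalence]
    [β.Monoidal] [β.IsEquivalence] (π : α ≅ β) [NatTrans.IsMonoidal π.hom]
    {X : C} (ψ : ∀ Y : C, X ⊗ Y ≅ Y ⊗ X)
    (hnat : ∀ {Y Z : C} (f : Y ⟶ Z), (X ◁ f) ≫ (ψ Z).hom = (ψ Y).hom ≫ (f ▷ X))
    (hmon : ∀ Y Z : C, (ψ (Y ⊗ Z)).hom =
      (α_ X Y Z).inv ≫ ((ψ Y).hom ▷ Z) ≫ (α_ Y X Z).hom ≫ (Y ◁ (ψ Z).hom) ≫ (α_ Y Z X).inv)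
    (Y : C) :
    (π.hom.app X ▷ Y) ≫ (conj β ψ Y).hom = (conj α ψ Y).hom ≫ (Y ◁ π.hom.app X) := by
  let W := β.asEquivalence.inverse.obj Y
  let c : β.obj W ≅ Y := β.asEquivalence.counitIso.app Y
  rw [← cancel_epi (α.obj X ◁ (π.hom.app W ≫ c.hom)),
    reassoc_of% whiskerLeft_comp_conj_hom α ψ hnat (π.hom.app W ≫ c.hom)]
  calc
    _ = (π.hom.app X ⊗ₘ π.hom.app W) ≫ (β.obj X ◁ c.hom) ≫ (conj β ψ Y).hom := by
      rw [whisker_exchange_assoc, whiskerLeft_comp_assoc, tensorHom_def_assoc]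
    _ = Functor.LaxMonoidal.μ α X W ≫ α.map (ψ W).hom ≫ Functor.OplaxMonoidal.δ α W X ≫
        (π.hom.app W ⊗ₘ π.hom.app X) ≫ (c.hom ▷ β.obj X) := by
      rw [whiskerLeft_comp_conj_hom β ψ hnat, ← NatTrans.IsMonoidal.tensor_assoc,
        ← π.hom.naturality_assoc, reassoc_of% app_tensor_comp_δ π.hom W X]
    _ = _ := by
      rw [← whisker_exchange, comp_whiskerRight, tensorHom_def'_assoc]

end DrinfeldConj
end

section
/- Let C be a monoidal category and let e, e' : C ≌ C be two monoidal equivalences with functors α, β, tensorators η^α, η^β and inverse-counit isomorphisms ξ^α, ξ^β; equip the composite equivalence e' ⋙ e (with functor α ∘ β) with the composite tensorator η^{αβ}_{X,Y} = α(η^β_{X,Y}) ∘ η^α_{βX, βY} and composite inverse-counit isomorphism ξ^{αβ}. Then for every object (X, ψ) of the Drinfeld center Z(C), the half-braiding obtained by applying the construction twice agrees with the one obtained from the composite: (ψ^β)^α = ψ^{αβ} as half-braidings on α(β(X)). -/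
open CategoryTheory MonoidalCategory

universe v u

namespace DrinfeldConj

variable {C : Type u} [Category.{v} C] [MonoidalCategory C]

/-- The component at `Y` of the counit of the equivalence `α`. -/
noncomputable def counitAppIso (α : C ⥤ C) [α.IsEquivalence] (Y : C) :
    α.obj (α.asEquivalence.inverse.obj Y) ≅ Y :=
  α.asEquivalence.counitIso.app Y

open Functor.LaxMonoidal Functor.OplaxMonoidal

theorem conj_hom (α : C ⥤ C) [α.Monoidal] [α.IsEquivalence]
    {X : C} (ψ : ∀ Y : C, X ⊗ Y ≅ Y ⊗ X) (Y : C) :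
    (conj α ψ Y).hom = (α.obj X ◁ (counitAppIso α Y).inv) ≫
      μ α X (α.asEquivalence.inverse.obj Y) ≫ α.map (ψ (α.asEquivalence.inverse.obj Y)).hom ≫
      δ α (α.asEquivalence.inverse.obj Y) X ≫ ((counitAppIso α Y).hom ▷ α.obj X) :=
  rfl

/-- The conjugated half-braiding may be computed from any preimage `Z` of `Y` under `α`. -/
theorem conj_hom_eq_of_iso (α : C ⥤ C) [α.Monoidal] [α.IsEquivalence]
    {X : C} (ψ : ∀ Y : C, X ⊗ Y ≅ Y ⊗ X)
    (hnat : ∀ {Y Z : C} (f : Y ⟶ Z), (X ◁ f) ≫ (ψ Z).hom = (ψ Y).hom ≫ (f ▷ X))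
    {Y Z : C} (c : α.obj Z ≅ Y) :
    (conj α ψ Y).hom = (α.obj X ◁ c.inv) ≫ μ α X Z ≫ α.map (ψ Z).hom ≫ δ α Z X ≫
      (c.hom ▷ α.obj X) := by
  obtain ⟨f, hf⟩ := α.map_surjective ((counitAppIso α Y).hom ≫ c.inv)
  have hinv : c.inv = (counitAppIso α Y).inv ≫ α.map f := by simp [hf]
  have hhom : (counitAppIso α Y).hom = α.map f ≫ c.hom := by simp [hf]
  have hψ : α.map (X ◁ f) ≫ α.map (ψ Z).hom = α.map (ψ _).hom ≫ α.map (f ▷ X) := by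
    rw [← α.map_comp, hnat, α.map_comp]
  rw [conj_hom, hhom, hinv, MonoidalCategory.whiskerLeft_comp, comp_whiskerRight, Category.assoc,
    μ_natural_right_assoc, reassoc_of% hψ, δ_natural_left_assoc]

/-- for two monoidal equivalences `α`, `β` of `C`, the composite functor
`α ∘ β = β ⋙ α` carries the composite tensorator `η^{αβ}_{X,Y} = α(η^β_{X,Y}) ∘ η^α_{βX,βY}`
(this is the tensorator of the composite monoidal structure on `β ⋙ α`), and applying the
conjugated-half-braiding construction twice agrees with applying it to the composite:
`(ψ^β)^α = ψ^{αβ}` as half-braidings on `α(β(X))`. -/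
theorem conj_comp (α β : C ⥤ C) [α.Monoidal] [α.IsEquivalence]
    [β.Monoidal] [β.IsEquivalence]
    {X : C} (ψ : ∀ Y : C, X ⊗ Y ≅ Y ⊗ X)
    (hnat : ∀ {Y Z : C} (f : Y ⟶ Z), (X ◁ f) ≫ (ψ Z).hom = (ψ Y).hom ≫ (f ▷ X))
    (hmon : ∀ Y Z : C, (ψ (Y ⊗ Z)).hom =
      (α_ X Y Z).inv ≫ ((ψ Y).hom ▷ Z) ≫ (α_ Y X Z).hom ≫ (Y ◁ (ψ Z).hom) ≫ (α_ Y Z X).inv)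
    (Y : C) :
    (conj (β ⋙ α) ψ Y).hom = (conj α (fun U => conj β ψ U) Y).hom := by
  rw [conj_hom_eq_of_iso (β ⋙ α) ψ hnat
    (α.mapIso (counitAppIso β (α.asEquivalence.inverse.obj Y)) ≪≫ counitAppIso α Y)]
  simp [conj_hom]

end DrinfeldConj
end
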